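/- For every t ≥ 3 the following hold: (i) for every integer l with t+1 ≤ l ≤ 2t there exist α ≥ 1, β with α+2β = 2^t, a natural number γ, and two additive extended perfect codes C₁, C₂ ⊆ Z₂^α × Z₄^β, both of dual type (α,β;γ,1), such that η(C₁,C₂) = 2^(2^t−l); (ii) for every integer l with t+1 ≤ l ≤ 2t+1 there exist α ≥ 1, β with α+2β = 2^t, natural numbers γ, δ with δ ≠ 1, and two additive extended perfect codes C₁, C₂ ⊆ Z₂^α × Z₄^β, both of dual type (α,β;γ,δ), such that η(C₁,C₂) = 2^(2^t−l). -/

import Mathlib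

open scoped BigOperators

/-- `Z2` is the ring of integers modulo 2. -/
abbrev Z2 : Type := ZMod 2

/-- `Z4` is the ring of integers modulo 4. -/
abbrev Z4 : Type := ZMod 4

/-- The ambient group `Z₂^α × Z₄^β` for additive codes. -/
abbrev Amb (α β : ℕ) : Type := (Fin α → Z2) × (Fin β → Z4)

/-- The inner product on `Z₂^α × Z₄^β`:
`⟨u,v⟩ = 2·(Σᵢ ūᵢ·v̄ᵢ) + Σⱼ uⱼ·vⱼ ∈ Z₄`, where the bar denotes the lift `0 ↦ 0`, `1 ↦ 1`
of binary coordinates into `Z₄`. -/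
def addInner {α β : ℕ} (u v : Amb α β) : Z4 :=
  2 * (∑ i, ((u.1 i).val : Z4) * ((v.1 i).val : Z4)) + ∑ j, u.2 j * v.2 j

lemma addInner_zero_left {α β : ℕ} (v : Amb α β) : addInner 0 v = 0 := by
  simp [addInner]

lemma addInner_add_left {α β : ℕ} (u u' v : Amb α β) :
    addInner (u + u') v = addInner u v + addInner u' v := by
  have key : ∀ x x' y : Z2,
      (2 : Z4) * ((((x + x').val : ℕ) : Z4) * ((y.val : ℕ) : Z4)) =
        2 * (((x.val : ℕ) : Z4) * ((y.val : ℕ) : Z4)) +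
          2 * (((x'.val : ℕ) : Z4) * ((y.val : ℕ) : Z4)) := by decide
  simp only [addInner, Prod.fst_add, Prod.snd_add, Pi.add_apply, add_mul,
    Finset.mul_sum, Finset.sum_add_distrib]
  rw [Finset.sum_congr rfl (fun i _ => key (u.1 i) (u'.1 i) (v.1 i)),
    Finset.sum_add_distrib]
  ring

lemma addInner_neg_left {α β : ℕ} (u v : Amb α β) :
    addInner (-u) v = - addInner u v := by
  have hn : ∀ x : Z2, (-x) = x := by decide
  have key : ∀ S T : Z4, 2 * S + -T = -(2 * S + T) := by decide
  simp only [addInner, Prod.fst_neg, Prod.snd_neg, Pi.neg_apply, hn, neg_mul]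
  rw [Finset.sum_neg_distrib]
  exact key _ _

/-- The additive dual `C^⊥ = {u : ⟨u,v⟩ = 0 for all v ∈ C}` of an additive code `C`. -/
def dualCode {α β : ℕ} (C : AddSubgroup (Amb α β)) : AddSubgroup (Amb α β) where
  carrier := {u | ∀ v ∈ C, addInner u v = 0}
  zero_mem' := fun v _ => addInner_zero_left v
  add_mem' := by
    intro a b ha hb v hv
    rw [addInner_add_left, ha v hv, hb v hv, add_zero]
  neg_mem' := by
    intro a ha v hv
    rw [addInner_neg_left, ha v hv, neg_zero]

/-- An additive code `C ⊆ Z₂^α × Z₄^β` is of type `(α,β;γ,δ)` when it is isomorphic,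
as an abelian group, to `Z₂^γ × Z₄^δ`; equivalently (which is how we state it),
`|C| = 2^(γ+2δ)` and the number of elements `x ∈ C` with `x + x = 0` is `2^(γ+δ)`. -/
def isOfType {α β : ℕ} (C : AddSubgroup (Amb α β)) (γ δ : ℕ) : Prop :=
  Nat.card C = 2 ^ (γ + 2 * δ) ∧
    Nat.card {x : Amb α β // x ∈ C ∧ x + x = 0} = 2 ^ (γ + δ)

/-- An additive code `C` is of type `(α,β;γ,δ;κ)` when it is of type `(α,β;γ,δ)` and
`2^κ` is the cardinality of the image of `{x ∈ C : x + x = 0}` under the projection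
onto the binary coordinates. -/
def isOfTypeK {α β : ℕ} (C : AddSubgroup (Amb α β)) (γ δ κ : ℕ) : Prop :=
  isOfType C γ δ ∧
    Nat.card ↥(Prod.fst '' {x : Amb α β | x ∈ C ∧ x + x = 0}) = 2 ^ κ

/-- The Gray map on one quaternary coordinate:
`0 ↦ (0,0)`, `1 ↦ (0,1)`, `2 ↦ (1,1)`, `3 ↦ (1,0)`. -/
def grayPhi (y : Z4) : Z2 × Z2 :=
  if y = 0 then (0, 0) else if y = 1 then (0, 1) else if y = 2 then (1, 1) else (1, 0)

/-- The Gray map `Φ : Z₂^α × Z₄^β → Z₂^(α+2β)` (with index set `Fin α ⊕ Fin β × Fin 2`),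
acting as the identity on the binary coordinates and as `grayPhi` coordinatewise on the
quaternary coordinates. -/
def grayMap {α β : ℕ} (u : Amb α β) : (Fin α ⊕ Fin β × Fin 2) → Z2 :=
  Sum.elim (fun a => u.1 a)
    (fun b => if b.2 = 0 then (grayPhi (u.2 b.1)).1 else (grayPhi (u.2 b.1)).2)

/-- The minimum Hamming distance of a binary code `S` equals `d`. -/
def minDistEq {ι : Type} [Fintype ι] (S : Set (ι → Z2)) (d : ℕ) : Prop :=
  (∀ x ∈ S, ∀ y ∈ S, x ≠ y → d ≤ hammingDist x y) ∧
    ∃ x ∈ S, ∃ y ∈ S, x ≠ y ∧ hammingDist x y = d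

/-- A quaternary linear perfect code of length `β = 2^(t-1)` (`t ≥ 3`): an additive
subgroup of `Z₄^β` whose Gray image has cardinality `2^(2β-t-1)` and minimum Hamming
distance `4`. -/
def isQuatPerfect (t β : ℕ) (C : AddSubgroup (Amb 0 β)) : Prop :=
  3 ≤ t ∧ β = 2 ^ (t - 1) ∧
    Nat.card ↥(grayMap '' (C : Set (Amb 0 β))) = 2 ^ (2 * β - t - 1) ∧
    minDistEq (grayMap '' (C : Set (Amb 0 β))) 4

/-- An additive extended perfect code with `α ≠ 0` and binary length `α + 2β = 2^t`:
an additive subgroup of `Z₂^α × Z₄^β` with `α ≥ 1` whose Gray image has cardinality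
`2^(2^t - t - 1)` and minimum Hamming distance `4`. -/
def isAddExtPerfect (t α β : ℕ) (C : AddSubgroup (Amb α β)) : Prop :=
  1 ≤ α ∧ α + 2 * β = 2 ^ t ∧
    Nat.card ↥(grayMap '' (C : Set (Amb α β))) = 2 ^ (2 ^ t - t - 1) ∧
    minDistEq (grayMap '' (C : Set (Amb α β))) 4

/-- The hom out of `Z₂^α × Z₄^β` is the sum of its restrictions to the coordinates. -/
lemma hom_apply_eq_sum {α β : ℕ} {H : Type*} [AddCommGroup H] (S : Amb α β →+ H)
    (v : Amb α β) :
    S v = ∑ i, S (Pi.single i (v.1 i), 0) + ∑ j, S (0, Pi.single j (v.2 j)) := by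
  have h1 : v = ∑ i, ((Pi.single i (v.1 i), 0) : Amb α β) +
      ∑ j, ((0, Pi.single j (v.2 j)) : Amb α β) := by
    refine Prod.ext ?_ ?_
    · simp [Prod.fst_sum, Finset.univ_sum_single]
    · simp [Prod.snd_sum, Finset.univ_sum_single]
  conv_lhs => rw [h1]
  simp only [map_add, map_sum]

/-- The hom `ZMod n → H` sending `1` to an element killed by `n`. -/
lemma exists_zmod_hom {H : Type*} [AddCommGroup H] (n : ℕ) (x : H) (hx : n • x = 0) :
    ∃ f : ZMod n →+ H, f 1 = x := by
  refine ⟨ZMod.lift n ⟨zmultiplesHom H x, by simpa using hx⟩, ?_⟩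
  have := ZMod.lift_coe n ⟨zmultiplesHom H x, by simpa using hx⟩ 1
  simpa using this

/-- A hom out of `Z₂^α × Z₄^β` with prescribed columns. -/
lemma exists_hom_of_columns {α β : ℕ} {H : Type*} [AddCommGroup H] (h : Fin α → H)
    (g : Fin β → H) (hh : ∀ i, 2 • h i = 0) (hg : ∀ j, 4 • g j = 0) :
    ∃ S : Amb α β →+ H, (∀ i, S (Pi.single i 1, 0) = h i) ∧
      ∀ j, S (0, Pi.single j 1) = g j := by
  choose f hf using fun i => exists_zmod_hom 2 (h i) (hh i)
  choose k hk using fun j => exists_zmod_hom 4 (g j) (hg j)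
  refine ⟨(∑ i, (f i).comp (Pi.evalAddMonoidHom _ i)).coprod
    (∑ j, (k j).comp (Pi.evalAddMonoidHom _ j)), fun i => ?_, fun j => ?_⟩
  · simp only [AddMonoidHom.coprod_apply, map_zero, add_zero, AddMonoidHom.finsetSum_apply,
      AddMonoidHom.comp_apply, Pi.evalAddMonoidHom_apply]
    rw [Finset.sum_eq_single i] <;> simp +contextual [hf]
  · simp only [AddMonoidHom.coprod_apply, map_zero, zero_add, AddMonoidHom.finsetSum_apply,
      AddMonoidHom.comp_apply, Pi.evalAddMonoidHom_apply]
    rw [Finset.sum_eq_single j] <;> simp +contextual [hk]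

lemma map_zmod_two {H : Type*} [AddCommGroup H] (f : Z2 →+ H) (a : Z2) :
    f a = a.val • f 1 := by
  rw [← map_nsmul, nsmul_one, ZMod.natCast_zmod_val]

lemma map_zmod_four {H : Type*} [AddCommGroup H] (f : Z4 →+ H) (a : Z4) :
    f a = a.val • f 1 := by
  rw [← map_nsmul, nsmul_one, ZMod.natCast_zmod_val]

lemma map_single_left {α β : ℕ} {H : Type*} [AddCommGroup H] (S : Amb α β →+ H)
    (i : Fin α) (a : Z2) :
    S (Pi.single i a, 0) = a.val • S (Pi.single i 1, 0) :=
  map_zmod_two (S.comp ((AddMonoidHom.inl _ _).comp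
    (AddMonoidHom.single (fun _ : Fin α => Z2) i))) a

lemma map_single_right {α β : ℕ} {H : Type*} [AddCommGroup H] (S : Amb α β →+ H)
    (j : Fin β) (a : Z4) :
    S (0, Pi.single j a) = a.val • S (0, Pi.single j 1) :=
  map_zmod_four (S.comp ((AddMonoidHom.inr _ _).comp
    (AddMonoidHom.single (fun _ : Fin β => Z4) j))) a

lemma hom_apply_eq_sum_columns {α β : ℕ} {H : Type*} [AddCommGroup H] (S : Amb α β →+ H)
    (v : Amb α β) :
    S v = ∑ i, (v.1 i).val • S (Pi.single i 1, 0) + ∑ j, (v.2 j).val • S (0, Pi.single j 1) := by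
  rw [hom_apply_eq_sum]
  congr 1
  · exact Finset.sum_congr rfl fun i _ => map_single_left S i _
  · exact Finset.sum_congr rfl fun j _ => map_single_right S j _

lemma eq_top_of_single_mem {γ δ : ℕ} (R : AddSubgroup (Amb γ δ))
    (h1 : ∀ i, ((Pi.single i 1, 0) : Amb γ δ) ∈ R)
    (h2 : ∀ j, ((0, Pi.single j 1) : Amb γ δ) ∈ R) (y : Amb γ δ) : y ∈ R := by
  rw [← AddMonoidHom.id_apply (Amb γ δ) y, hom_apply_eq_sum_columns]
  exact add_mem (sum_mem fun i _ => nsmul_mem (h1 i) _) (sum_mem fun j _ => nsmul_mem (h2 j) _)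

/-! ### The inner product as a perfect pairing -/

lemma addInner_single_left {α β : ℕ} (w : Amb α β) (i : Fin α) (a : Z2) :
    addInner w (Pi.single i a, 0) = 2 * (((w.1 i).val : Z4) * (a.val : Z4)) := by
  rw [addInner, Finset.sum_eq_single i] <;> simp +contextual

lemma addInner_single_right {α β : ℕ} (w : Amb α β) (j : Fin β) (a : Z4) :
    addInner w (0, Pi.single j a) = w.2 j * a := by
  simp [addInner, Pi.single_apply]

lemma addInner_comm {α β : ℕ} (u v : Amb α β) : addInner u v = addInner v u := by
  simp [addInner, mul_comm]

/-- Pairing with a fixed vector, as a hom. -/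
def innerHom {α β : ℕ} (w : Amb α β) : Amb α β →+ Z4 :=
  AddMonoidHom.mk' (addInner w) fun a b => by
    rw [addInner_comm, addInner_add_left, addInner_comm a, addInner_comm b]

@[simp] lemma innerHom_apply {α β : ℕ} (w v : Amb α β) : innerHom w v = addInner w v := rfl

lemma addInner_left_injective {α β : ℕ} {w w' : Amb α β}
    (h : ∀ v, addInner w v = addInner w' v) : w = w' := by
  have key : ∀ a b : Z2, (2 : Z4) * ((a.val : Z4) * ((1 : Z2).val : Z4)) =
      2 * ((b.val : Z4) * ((1 : Z2).val : Z4)) → a = b := by decide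
  refine Prod.ext (funext fun i => ?_) (funext fun j => ?_)
  · have := h (Pi.single i 1, 0)
    rw [addInner_single_left, addInner_single_left] at this
    exact key _ _ this
  · have := h (0, Pi.single j 1)
    simpa only [addInner_single_right, mul_one] using this

lemma exists_addInner_eq {α β : ℕ} (φ : Amb α β →+ Z4) : ∃ w, ∀ v, addInner w v = φ v := by
  have key : ∀ a : Z4, a + a = 0 →
      2 * (((if a = 0 then 0 else 1 : Z2).val : Z4) * ((1 : Z2).val : Z4)) = a := by decide
  refine ⟨(fun i => if φ (Pi.single i 1, 0) = 0 then 0 else 1,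
    fun j => φ (0, Pi.single j 1)), fun v => ?_⟩
  rw [← innerHom_apply, hom_apply_eq_sum_columns (innerHom _) v, hom_apply_eq_sum_columns φ v]
  congr 1
  · refine Finset.sum_congr rfl fun i _ => ?_
    rw [innerHom_apply, addInner_single_left]
    dsimp only
    rw [key]
    rw [← map_add, Prod.mk_add_mk, ← Pi.single_add]
    rw [(by decide : (1 + 1 : Z2) = 0), Pi.single_zero, add_zero]
    exact map_zero φ
  · refine Finset.sum_congr rfl fun j _ => ?_
    rw [innerHom_apply, addInner_single_right, mul_one]

/-! ### Cardinalities and the type of the dual of a kernel -/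

lemma card_amb (α β : ℕ) : Nat.card (Amb α β) = 2 ^ (α + 2 * β) := by
  simp [Nat.card_eq_fintype_card, ZMod.card, pow_add, pow_mul]

lemma card_amb_two_torsion (γ δ : ℕ) :
    Nat.card {x : Amb γ δ // x + x = 0} = 2 ^ (γ + δ) := by
  have key : ∀ a : Z4, (a + a = 0 ↔ a ∈ ({0, 2} : Finset Z4)) := by decide
  have key2 : ∀ a : Z2, a + a = 0 := by decide
  have e : {x : Amb γ δ // x + x = 0} ≃ (Fin γ → Z2) × (Fin δ → ({0, 2} : Finset Z4)) :=
    { toFun := fun x => (x.1.1, fun j => ⟨x.1.2 j, (key _).1 (by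
        simpa using congrFun (congrArg Prod.snd x.2) j)⟩)
      invFun := fun x => ⟨(x.1, fun j => (x.2 j).1), Prod.ext (funext fun i => key2 _)
        (funext fun j => (key _).2 (x.2 j).2)⟩
      left_inv := fun x => rfl
      right_inv := fun x => rfl }
  have c : Fintype.card ({0, 2} : Finset Z4) = 2 := by decide
  rw [Nat.card_congr e, Nat.card_eq_fintype_card, Fintype.card_prod, Fintype.card_fun,
    Fintype.card_fun, c]
  simp [ZMod.card, pow_add]

/-- If `S` is onto `Z₂^γ × Z₄^δ`, the dual of its kernel is of type `(α,β;γ,δ)`. -/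
lemma isOfType_dualCode_ker {α β γ δ : ℕ} (S : Amb α β →+ Amb γ δ)
    (hS : Function.Surjective S) : isOfType (dualCode S.ker) γ δ := by
  choose T hT using fun a => exists_addInner_eq ((innerHom a).comp S)
  have hT' : ∀ a v, addInner (T a) v = addInner a (S v) := fun a v => by simpa using hT a v
  have hadd : ∀ a b, T (a + b) = T a + T b := fun a b =>
    addInner_left_injective fun v => by rw [hT', addInner_add_left, addInner_add_left, hT', hT']
  have hinj : Function.Injective T := fun a b hab => addInner_left_injective fun y => by
    obtain ⟨v, rfl⟩ := hS y
    rw [← hT', ← hT', hab]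
  have h0 : T 0 = 0 := by simpa using hadd 0 0
  have hmem : ∀ a, T a ∈ dualCode S.ker := fun a v hv => by
    rw [hT', (hv : S v = 0)]
    exact map_zero (innerHom a)
  have hsurj : ∀ w ∈ dualCode S.ker, ∃ a, T a = w := by
    intro w hw
    have hle : S.ker ≤ (innerHom w).ker := fun v hv => hw v hv
    obtain ⟨a, ha⟩ := exists_addInner_eq
      (S.liftOfSurjective hS ⟨innerHom w, hle⟩)
    refine ⟨a, addInner_left_injective fun v => ?_⟩
    rw [hT', ha]
    exact S.liftOfRightInverse_comp_apply _ (Function.rightInverse_surjInv hS)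
      ⟨innerHom w, hle⟩ v
  constructor
  · rw [← card_amb γ δ]
    exact (Nat.card_eq_of_bijective (fun a => (⟨T a, hmem a⟩ : dualCode S.ker))
      ⟨fun a b hab => hinj (congrArg Subtype.val hab), fun w => by
        obtain ⟨a, ha⟩ := hsurj w.1 w.2
        exact ⟨a, Subtype.ext ha⟩⟩).symm
  · rw [← card_amb_two_torsion γ δ]
    refine (Nat.card_eq_of_bijective (fun a : {x : Amb γ δ // x + x = 0} =>
      (⟨T a.1, hmem a.1, by rw [← hadd, a.2, h0]⟩ :
        {x : Amb α β // x ∈ dualCode S.ker ∧ x + x = 0})) ⟨fun a b hab => ?_, fun w => ?_⟩).symm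
    · exact Subtype.ext (hinj (congrArg Subtype.val hab))
    · obtain ⟨a, ha⟩ := hsurj w.1 w.2.1
      refine ⟨⟨a, hinj ?_⟩, Subtype.ext ha⟩
      rw [hadd, ha, w.2.2, h0]

lemma card_ker_mul {G K : Type*} [AddCommGroup G] [AddCommGroup K] [Finite G] (T : G →+ K)
    (hT : Function.Surjective T) : Nat.card T.ker * Nat.card K = Nat.card G := by
  rw [← AddSubgroup.card_mul_index T.ker, AddSubgroup.index_ker,
    AddMonoidHom.range_eq_top.2 hT, AddSubgroup.card_top]

/-- The size of the intersection of two kernels whose homs differ by values in `W`. -/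
lemma card_ker_inf_ker {G H : Type*} [AddCommGroup G] [AddCommGroup H] [Finite G]
    (S₁ S₂ : G →+ H) (W : AddSubgroup H) (hW : ∀ v, S₂ v - S₁ v ∈ W)
    (h1 : ∀ y, (y, 0) ∈ (S₁.prod (S₂ - S₁)).range)
    (h2 : ∀ w ∈ W, (0, w) ∈ (S₁.prod (S₂ - S₁)).range) :
    Nat.card ↥(S₁.ker ⊓ S₂.ker) * (Nat.card H * Nat.card W) = Nat.card G := by
  let T : G →+ H × W := S₁.prod ((S₂ - S₁).codRestrict W hW)
  have hker : T.ker = S₁.ker ⊓ S₂.ker := by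
    ext v
    have : T v = 0 ↔ S₁ v = 0 ∧ S₂ v - S₁ v = 0 := by
      rw [Prod.ext_iff, Subtype.ext_iff]
      rfl
    rw [AddMonoidHom.mem_ker, this, AddSubgroup.mem_inf, AddMonoidHom.mem_ker,
      AddMonoidHom.mem_ker]
    constructor
    · rintro ⟨a, b⟩
      exact ⟨a, by simpa [a] using b⟩
    · rintro ⟨a, b⟩
      exact ⟨a, by simp [a, b]⟩
  have hsurj : Function.Surjective T := by
    rintro ⟨y, w, hw⟩
    obtain ⟨a, ha⟩ := add_mem (h1 y) (h2 w hw)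
    refine ⟨a, ?_⟩
    simp only [Prod.mk_add_mk, add_zero, zero_add, AddMonoidHom.prod_apply, Prod.mk.injEq] at ha
    exact Prod.ext ha.1 (Subtype.ext ha.2)
  rw [← hker, ← Nat.card_prod]
  exact card_ker_mul T hsurj

/-! ### Minimum distance -/

/-- The Lee weight on `Z₄`. -/
def leeWeight (a : Z4) : ℕ := if a = 0 then 0 else if a = 2 then 2 else 1

/-- The weight of the Gray image on one coordinate. -/
def coordWeight {α β : ℕ} (w : Amb α β) : Fin α ⊕ Fin β → ℕ :=
  Sum.elim (fun i => if w.1 i = 0 then 0 else 1) (fun j => leeWeight (w.2 j))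

lemma hammingDist_grayMap {α β : ℕ} (u v : Amb α β) :
    hammingDist (grayMap u) (grayMap v) = ∑ k, coordWeight (u - v) k := by
  have key : ∀ a b : Z4, (if (grayPhi a).1 ≠ (grayPhi b).1 then 1 else 0) +
      (if (grayPhi a).2 ≠ (grayPhi b).2 then 1 else 0) = leeWeight (a - b) := by decide
  rw [hammingDist, Finset.card_filter, Fintype.sum_sum_type, Fintype.sum_sum_type,
    Fintype.sum_prod_type]
  congr 1
  · refine Finset.sum_congr rfl fun i _ => ?_
    by_cases h : u.1 i = v.1 i <;> simp [grayMap, coordWeight, sub_eq_zero, h]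
  · refine Finset.sum_congr rfl fun j _ => ?_
    rw [Fin.sum_univ_two]
    exact key _ _

lemma coordWeight_eq_zero {α β : ℕ} {w : Amb α β} (h : ∀ k, coordWeight w k = 0) : w = 0 := by
  have key : ∀ a : Z4, leeWeight a = 0 → a = 0 := by decide
  refine Prod.ext (funext fun i => ?_) (funext fun j => ?_)
  · simpa [coordWeight] using h (Sum.inl i)
  · exact key _ (h (Sum.inr j))

lemma grayMap_injective {α β : ℕ} : Function.Injective (grayMap (α := α) (β := β)) := by
  intro u v huv
  have h := hammingDist_grayMap u v
  rw [huv, hammingDist_self] at h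
  have h' := (Finset.sum_eq_zero_iff_of_nonneg (fun _ _ => Nat.zero_le _)).1 h.symm
  exact sub_eq_zero.1 (coordWeight_eq_zero fun k => h' k (Finset.mem_univ k))

lemma sum_eq_two_cases {κ : Type*} [Fintype κ] [DecidableEq κ] (f : κ → ℕ)
    (hf : ∑ k, f k = 2) :
    (∃ k, f k = 2 ∧ ∀ l, l ≠ k → f l = 0) ∨
      ∃ k l, k ≠ l ∧ f k = 1 ∧ f l = 1 ∧ ∀ m, m ≠ k → m ≠ l → f m = 0 := by
  obtain ⟨k, hk⟩ : ∃ k, f k ≠ 0 := by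
    by_contra! h
    simp [h] at hf
  rw [← Finset.add_sum_erase _ _ (Finset.mem_univ k)] at hf
  obtain hk2 | hk1 : f k = 2 ∨ f k = 1 := by omega
  · left
    have h0 : ∑ l ∈ Finset.univ.erase k, f l = 0 := by omega
    rw [Finset.sum_eq_zero_iff] at h0
    exact ⟨k, hk2, fun l hl => h0 l (by simp [hl])⟩
  · right
    have h1 : ∑ l ∈ Finset.univ.erase k, f l = 1 := by omega
    obtain ⟨l, hl, hl0⟩ : ∃ l ∈ Finset.univ.erase k, f l ≠ 0 := by
      by_contra! h
      rw [Finset.sum_eq_zero h] at h1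
      omega
    rw [← Finset.add_sum_erase _ _ hl] at h1
    have hl1 : f l = 1 := by omega
    have h0 : ∑ m ∈ (Finset.univ.erase k).erase l, f m = 0 := by omega
    rw [Finset.sum_eq_zero_iff] at h0
    exact ⟨k, l, fun h => by simp [h] at hl, hk1, hl1, fun m hmk hml => h0 m (by simp [hmk, hml])⟩

/-- The contribution of one coordinate to a syndrome. -/
def coordTerm {α β : ℕ} {H : Type*} [AddCommGroup H] (S : Amb α β →+ H) (w : Amb α β) :
    Fin α ⊕ Fin β → H :=
  Sum.elim (fun i => S (Pi.single i (w.1 i), 0)) (fun j => S (0, Pi.single j (w.2 j)))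

lemma hom_eq_sum_coordTerm {α β : ℕ} {H : Type*} [AddCommGroup H] (S : Amb α β →+ H)
    (w : Amb α β) : S w = ∑ k, coordTerm S w k := by
  rw [hom_apply_eq_sum, Fintype.sum_sum_type]
  rfl

/-- The conditions on the columns of a parity check hom that make its kernel
an extended perfect code. -/
structure GoodColumns {α β : ℕ} {H : Type*} [AddCommGroup H] (S : Amb α β →+ H)
    (h : Fin α → H) (g : Fin β → H) (ε : H →+ Z2) : Prop where
  left : ∀ i, S (Pi.single i 1, 0) = h i
  right : ∀ j, S (0, Pi.single j 1) = g j
  parity_left : ∀ i, ε (h i) = 1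
  parity_right : ∀ j, ε (g j) = 1
  two_left : ∀ i, h i + h i = 0
  inj : Function.Injective h
  two_right : ∀ j, g j + g j ≠ 0
  ne : ∀ i j, i ≠ j → g i ≠ g j
  ne_neg : ∀ i j, i ≠ j → g i ≠ - g j
  four : ∃ s : Finset (Fin α), s.card = 4 ∧ ∑ i ∈ s, h i = 0

namespace GoodColumns

variable {α β : ℕ} {H : Type*} [AddCommGroup H] {S : Amb α β →+ H}
  {h : Fin α → H} {g : Fin β → H} {ε : H →+ Z2}

lemma coordTerm_of_weight_zero (S : Amb α β →+ H) {w : Amb α β} {k : Fin α ⊕ Fin β}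
    (hk : coordWeight w k = 0) : coordTerm S w k = 0 := by
  have key : ∀ a : Z4, leeWeight a = 0 → a = 0 := by decide
  rcases k with i | j
  · have : w.1 i = 0 := by simpa [coordWeight] using hk
    simp only [coordTerm, Sum.elim_inl, this, Pi.single_zero]
    exact map_zero S
  · have : w.2 j = 0 := key _ hk
    simp only [coordTerm, Sum.elim_inr, this, Pi.single_zero]
    exact map_zero S

lemma coordTerm_inl (hS : GoodColumns S h g ε) {w : Amb α β} {i : Fin α}
    (hk : coordWeight w (Sum.inl i) = 1) : coordTerm S w (Sum.inl i) = h i := by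
  have key : ∀ a : Z2, a ≠ 0 → a = 1 := by decide
  have : w.1 i = 1 := key _ fun h0 => by simp [coordWeight, h0] at hk
  simp [coordTerm, this, hS.left]

lemma coordTerm_inr (hS : GoodColumns S h g ε) {w : Amb α β} {j : Fin β}
    (hk : coordWeight w (Sum.inr j) = 1) :
    coordTerm S w (Sum.inr j) = g j ∨ coordTerm S w (Sum.inr j) = - g j := by
  have key : ∀ a : Z4, leeWeight a = 1 → a = 1 ∨ a = -1 := by decide
  rcases key _ hk with h1 | h1
  · left
    simp [coordTerm, h1, hS.right]
  · right
    have : ((0, Pi.single j (-1)) : Amb α β) = - (0, Pi.single j 1) := by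
      simp [Pi.single_neg]
    simp only [coordTerm, Sum.elim_inr, h1]
    rw [this, map_neg, hS.right]

lemma parity (hS : GoodColumns S h g ε) (w : Amb α β) :
    ε (S w) = ((∑ k, coordWeight w k : ℕ) : Z2) := by
  have key2 : ∀ a : Z2, ((a.val : ℕ) : Z2) = ((if a = 0 then 0 else 1 : ℕ) : Z2) := by decide
  have key4 : ∀ a : Z4, ((a.val : ℕ) : Z2) = ((leeWeight a : ℕ) : Z2) := by decide
  rw [hom_eq_sum_coordTerm, map_sum, Nat.cast_sum]
  refine Finset.sum_congr rfl fun k _ => ?_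
  rcases k with i | j
  · rw [coordTerm, Sum.elim_inl, map_single_left, map_nsmul, hS.left, hS.parity_left, nsmul_one]
    exact key2 _
  · rw [coordTerm, Sum.elim_inr, map_single_right, map_nsmul, hS.right, hS.parity_right,
      nsmul_one]
    exact key4 _

lemma left_ne_right (hS : GoodColumns S h g ε) (i : Fin α) (j : Fin β) :
    h i + g j ≠ 0 ∧ h i + - g j ≠ 0 := by
  constructor <;> intro h0
  · refine hS.two_right j ?_
    rw [← neg_eq_of_add_eq_zero_right h0, ← neg_add, hS.two_left, neg_zero]
  · refine hS.two_right j ?_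
    rw [← add_neg_eq_zero.1 h0, hS.two_left]

lemma weight_ne_two (hS : GoodColumns S h g ε) {w : Amb α β} (hw : S w = 0) :
    ∑ k, coordWeight w k ≠ 2 := by
  intro hsum
  rcases sum_eq_two_cases _ hsum with ⟨k, hk, hz⟩ | ⟨k, l, hkl, hk, hl, hz⟩
  · rw [hom_eq_sum_coordTerm, Finset.sum_eq_single k
      (fun l _ hl => coordTerm_of_weight_zero S (hz l hl)) (by simp)] at hw
    rcases k with i | j
    · simp only [coordWeight, Sum.elim_inl] at hk
      split_ifs at hk
      omega
    · have key : ∀ a : Z4, leeWeight a = 2 → a = 2 := by decide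
      have h2 : w.2 j = 2 := key _ hk
      rw [coordTerm, Sum.elim_inr, h2, map_single_right, hS.right] at hw
      refine hS.two_right j ?_
      rw [← two_nsmul]
      exact hw
  · rw [hom_eq_sum_coordTerm, Finset.sum_eq_add k l hkl
      (fun m _ hm => coordTerm_of_weight_zero S (hz m hm.1 hm.2)) (by simp) (by simp)] at hw
    rcases k with i | j <;> rcases l with i' | j'
    · rw [hS.coordTerm_inl hk, hS.coordTerm_inl hl] at hw
      refine hkl (congrArg Sum.inl (hS.inj ?_))
      rw [eq_neg_of_add_eq_zero_left hw, neg_eq_of_add_eq_zero_left (hS.two_left i')]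
    · rw [hS.coordTerm_inl hk] at hw
      rcases hS.coordTerm_inr hl with h1 | h1 <;> rw [h1] at hw
      · exact (hS.left_ne_right _ _).1 hw
      · exact (hS.left_ne_right _ _).2 hw
    · rw [hS.coordTerm_inl hl, add_comm] at hw
      rcases hS.coordTerm_inr hk with h1 | h1 <;> rw [h1] at hw
      · exact (hS.left_ne_right _ _).1 hw
      · exact (hS.left_ne_right _ _).2 hw
    · have hne : j ≠ j' := fun h0 => hkl (congrArg Sum.inr h0)
      rcases hS.coordTerm_inr hk with h1 | h1 <;> rcases hS.coordTerm_inr hl with h2 | h2 <;>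
        rw [h1, h2] at hw
      · exact hS.ne_neg _ _ hne (eq_neg_of_add_eq_zero_left hw)
      · exact hS.ne _ _ hne (add_neg_eq_zero.1 hw)
      · exact hS.ne _ _ hne (neg_add_eq_zero.1 hw)
      · exact hS.ne_neg _ _ hne (by simpa using congrArg Neg.neg (eq_neg_of_add_eq_zero_left hw))

lemma minDistEq_four (hS : GoodColumns S h g ε) :
    minDistEq (grayMap '' (S.ker : Set (Amb α β))) 4 := by
  constructor
  · rintro _ ⟨u, hu, rfl⟩ _ ⟨v, hv, rfl⟩ huv
    have hw : S (u - v) = 0 := by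
      rw [map_sub, (hu : S u = 0), (hv : S v = 0), sub_zero]
    rw [← hammingDist_pos, hammingDist_grayMap] at huv
    rw [hammingDist_grayMap]
    have h2 := hS.weight_ne_two hw
    have hp := hS.parity (u - v)
    rw [hw, map_zero, eq_comm, ZMod.natCast_eq_zero_iff] at hp
    omega
  · obtain ⟨s, hs, hs0⟩ := hS.four
    let w : Amb α β := (fun i => if i ∈ s then 1 else 0, 0)
    have hwt : hammingDist (grayMap w) (grayMap 0) = 4 := by
      rw [hammingDist_grayMap, Fintype.sum_sum_type]
      simp [coordWeight, w, leeWeight, hs]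
    have hSw : S w = 0 := by
      rw [hom_apply_eq_sum_columns, ← hs0]
      simp [w, hS.left, apply_ite ZMod.val, ite_smul, ZMod.val_one]
    refine ⟨_, ⟨w, hSw, rfl⟩, _, ⟨0, zero_mem _, rfl⟩, fun h0 => ?_, hwt⟩
    rw [h0, hammingDist_self] at hwt
    omega

end GoodColumns

lemma isAddExtPerfect_ker {t α β γ δ : ℕ} {S : Amb α β →+ Amb γ δ} {h : Fin α → Amb γ δ}
    {g : Fin β → Amb γ δ} {ε : Amb γ δ →+ Z2} (hS : GoodColumns S h g ε)
    (hsurj : Function.Surjective S) (hα : 1 ≤ α) (hαβ : α + 2 * β = 2 ^ t)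
    (hγδ : γ + 2 * δ = t + 1) : isAddExtPerfect t α β S.ker := by
  refine ⟨hα, hαβ, ?_, hS.minDistEq_four⟩
  rw [Nat.card_image_of_injective grayMap_injective]
  have h1 := card_ker_mul S hsurj
  rw [card_amb, card_amb, hαβ, hγδ] at h1
  refine Nat.eq_of_mul_eq_mul_right (Nat.pow_pos (n := t + 1) (Nat.zero_lt_two)) ?_
  have h2 : t + 1 ≤ 2 ^ t := Nat.lt_two_pow_self
  refine h1.trans ?_
  rw [← pow_add]
  congr 1
  omega

/-! ### A cycle on `k + 1` affinely independent binary points -/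

/-- The points `0, e₀, …, e_{k-1}`. -/
def cyclePoint {n k : ℕ} (hk : k ≤ n) : Fin (k + 1) → Fin n → Z2 :=
  Fin.cons 0 fun i => Pi.single (Fin.castLE hk i) 1

lemma cyclePoint_injective {n k : ℕ} (hk : k ≤ n) : Function.Injective (cyclePoint hk) := by
  rw [cyclePoint, Fin.cons_injective_iff]
  constructor
  · rintro ⟨i, hi⟩
    simp at hi
  · intro i j hij
    have : Fin.castLE hk i = Fin.castLE hk j := by
      by_contra hne
      have := congrFun hij (Fin.castLE hk i)
      simp [hne] at this
    exact Fin.castLE_injective hk this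

/-- The cycle `0 → e₀ → ⋯ → e_{k-1} → 0`. -/
def cyclePerm {n k : ℕ} (hk : k ≤ n) : Equiv.Perm (Fin n → Z2) :=
  (finRotate (k + 1)).viaFintypeEmbedding ⟨cyclePoint hk, cyclePoint_injective hk⟩

lemma cyclePerm_cyclePoint {n k : ℕ} (hk : k ≤ n) (i : Fin (k + 1)) :
    cyclePerm hk (cyclePoint hk i) = cyclePoint hk (finRotate (k + 1) i) :=
  Equiv.Perm.viaFintypeEmbedding_apply_image (finRotate (k + 1))
    ⟨cyclePoint hk, cyclePoint_injective hk⟩ i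

lemma cyclePerm_of_notMem {n k : ℕ} (hk : k ≤ n) {x : Fin n → Z2}
    (hx : x ∉ Set.range (cyclePoint hk)) : cyclePerm hk x = x :=
  Equiv.Perm.viaFintypeEmbedding_apply_notMem_range (finRotate (k + 1))
    ⟨cyclePoint hk, cyclePoint_injective hk⟩ hx

lemma cyclePerm_fixed {n k : ℕ} (hk : k ≤ n) {x : Fin n → Z2} {a b : Fin n} (hab : a ≠ b)
    (ha : x a = 1) (hb : x b = 1) : cyclePerm hk x = x := by
  refine cyclePerm_of_notMem hk ?_
  rintro ⟨i, rfl⟩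
  induction i using Fin.cases with
  | zero => simp [cyclePoint] at ha
  | succ i =>
    simp only [cyclePoint, Fin.cons_succ, Pi.single_apply] at ha hb
    split_ifs at ha hb with h1 h2
    · exact hab (h1.trans h2.symm)
    all_goals simp at ha hb

/-- The vectors supported on the first `k` coordinates. -/
def firstCoords (n k : ℕ) : AddSubgroup (Fin n → Z2) where
  carrier := {x | ∀ i : Fin n, k ≤ i → x i = 0}
  zero_mem' := fun _ _ => rfl
  add_mem' := fun ha hb i hi => by simp [ha i hi, hb i hi]
  neg_mem' := fun ha i hi => by simp [ha i hi]

lemma card_firstCoords {n k : ℕ} (hk : k ≤ n) : Nat.card (firstCoords n k) = 2 ^ k := by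
  have e : firstCoords n k ≃ (Fin k → Z2) :=
    { toFun := fun x i => x.1 (Fin.castLE hk i)
      invFun := fun y => ⟨fun i => if h : (i : ℕ) < k then y ⟨i, h⟩ else 0,
        fun i hi => dif_neg (not_lt.2 hi)⟩
      left_inv := fun x => Subtype.ext (funext fun i => by
        by_cases h : (i : ℕ) < k
        · simp [h]
        · simpa [h] using (x.2 i (not_lt.1 h)).symm)
      right_inv := fun y => funext fun i => by simp }
  rw [Nat.card_congr e]
  simp [Nat.card_eq_fintype_card, ZMod.card]

lemma cyclePoint_mem {n k : ℕ} (hk : k ≤ n) (i : Fin (k + 1)) :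
    cyclePoint hk i ∈ firstCoords n k := by
  induction i using Fin.cases with
  | zero => exact zero_mem _
  | succ i =>
    intro j hj
    have : j ≠ Fin.castLE hk i := by
      rintro rfl
      have := i.2
      simp at hj
      omega
    simp [cyclePoint, this]

lemma cyclePerm_sub_mem {n k : ℕ} (hk : k ≤ n) (x : Fin n → Z2) :
    cyclePerm hk x - x ∈ firstCoords n k := by
  by_cases hx : x ∈ Set.range (cyclePoint hk)
  · obtain ⟨i, rfl⟩ := hx
    rw [cyclePerm_cyclePoint]
    exact sub_mem (cyclePoint_mem hk _) (cyclePoint_mem hk _)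
  · rw [cyclePerm_of_notMem hk hx, sub_self]
    exact zero_mem _

/-- A subgroup containing all displacements of the cycle contains `firstCoords n k`. -/
lemma firstCoords_le {n k : ℕ} (hk : k ≤ n) (R : AddSubgroup (Fin n → Z2))
    (hR : ∀ x, cyclePerm hk x - x ∈ R) : firstCoords n k ≤ R := by
  have hp : ∀ i, cyclePoint hk i ∈ R := by
    intro i
    induction i using Fin.induction with
    | zero => exact zero_mem _
    | succ i ih =>
      have h1 := hR (cyclePoint hk i.castSucc)
      rw [cyclePerm_cyclePoint, finRotate_apply, Fin.coeSucc_eq_succ] at h1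
      simpa using add_mem h1 ih
  intro x hx
  rw [← Finset.univ_sum_single x]
  refine sum_mem fun i _ => ?_
  have key : ∀ a : Z2, a = 0 ∨ a = 1 := by decide
  rcases key (x i) with h0 | h1
  · rw [h0, Pi.single_zero]
    exact zero_mem _
  · rw [h1]
    have hi : (i : ℕ) < k := by
      by_contra hi
      rw [hx i (not_lt.1 hi)] at h1
      exact absurd h1 (by decide)
    exact hp (Fin.succ ⟨i, hi⟩)

/-- Four affinely dependent points of a binary space of dimension at least two. -/
lemma exists_four_points {n : ℕ} (hn : 2 ≤ n) :
    ∃ s : Finset (Fin n → Z2), s.card = 4 ∧ ∑ x ∈ s, x = 0 := by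
  have h01 : (⟨0, by omega⟩ : Fin n) ≠ ⟨1, by omega⟩ := by simp
  generalize (⟨0, by omega⟩ : Fin n) = a at h01
  generalize (⟨1, by omega⟩ : Fin n) = b at h01
  let p : Z2 × Z2 ↪ (Fin n → Z2) := ⟨fun c => Pi.single a c.1 + Pi.single b c.2, fun c d h => by
    have h1 := congrFun h a
    have h2 := congrFun h b
    simp [h01, h01.symm] at h1 h2
    exact Prod.ext h1 h2⟩
  refine ⟨Finset.univ.map p, by simp, ?_⟩
  have key : ∑ x : Z2 × Z2, x.1 = 0 ∧ ∑ x : Z2 × Z2, x.2 = 0 := by decide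
  rw [Finset.sum_map]
  have h1 : ∑ x : Z2 × Z2, p x = Pi.single a (∑ x : Z2 × Z2, x.1) +
      Pi.single b (∑ x : Z2 × Z2, x.2) := by
    refine (Finset.sum_add_distrib (s := Finset.univ)
      (f := fun x : Z2 × Z2 => (Pi.single a x.1 : Fin n → Z2))).trans ?_
    congr 1
    · exact (map_sum (AddMonoidHom.single (fun _ : Fin n => Z2) a) _ _).symm
    · exact (map_sum (AddMonoidHom.single (fun _ : Fin n => Z2) b) _ _).symm
  rw [h1, key.1, key.2]
  simp

/-- Two extended perfect codes obtained by permuting the binary columns `c + ι x` of a parity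
check hom along a cycle, and the size of their intersection. -/
lemma exists_pair {t n β γ δ k : ℕ} (hn : 2 ≤ n) (hk : k ≤ n)
    (hαβ : 2 ^ n + 2 * β = 2 ^ t) (hγδ : γ + 2 * δ = t + 1) (hkt : t + 1 + k ≤ 2 ^ t)
    (ι : (Fin n → Z2) →+ Amb γ δ) (hι : Function.Injective ι) (c : Amb γ δ) (hc : c + c = 0)
    (g : Fin β → Amb γ δ) (ε : Amb γ δ →+ Z2) (hεc : ε c = 1) (hει : ∀ x, ε (ι x) = 0)
    (hεg : ∀ j, ε (g j) = 1) (hg2 : ∀ j, g j + g j ≠ 0)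
    (hg : ∀ i j, i ≠ j → g i ≠ g j) (hg' : ∀ i j, i ≠ j → g i ≠ - g j)
    (hgen : ∀ R : AddSubgroup (Amb γ δ), (∀ j, g j ∈ R) →
      (∀ (x : Fin n → Z2) (a b : Fin n), a ≠ b → x a = 1 → x b = 1 → c + ι x ∈ R) → ∀ y, y ∈ R) :
    ∃ C₁ C₂ : AddSubgroup (Amb (2 ^ n) β),
      isAddExtPerfect t (2 ^ n) β C₁ ∧ isAddExtPerfect t (2 ^ n) β C₂ ∧
      isOfType (dualCode C₁) γ δ ∧ isOfType (dualCode C₂) γ δ ∧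
      Nat.card ↥(C₁ ⊓ C₂) = 2 ^ (2 ^ t - (t + 1 + k)) := by
  have hV2 : ∀ x : Fin n → Z2, x + x = 0 := fun x =>
    funext fun i => (by decide : ∀ a : Z2, a + a = 0) (x i)
  have h4 : ∀ y : Amb γ δ, 4 • y = 0 := fun y => Prod.ext
    (funext fun i => (by decide : ∀ a : Z2, 4 • a = 0) (y.1 i))
    (funext fun i => (by decide : ∀ a : Z4, 4 • a = 0) (y.2 i))
  have h2 : ∀ x, (c + ι x) + (c + ι x) = 0 := fun x => by
    rw [add_add_add_comm, hc, ← map_add, hV2, map_zero, zero_add]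
  let e : Fin (2 ^ n) ≃ (Fin n → Z2) :=
    (Fintype.equivFinOfCardEq (by simp [ZMod.card])).symm
  have main : ∀ π : Equiv.Perm (Fin n → Z2), ∃ S : Amb (2 ^ n) β →+ Amb γ δ,
      GoodColumns S (fun i => c + ι (π (e i))) g ε := by
    intro π
    obtain ⟨S, hl, hr⟩ := exists_hom_of_columns (fun i => c + ι (π (e i))) g
      (fun i => by rw [two_nsmul, h2]) (fun j => h4 _)
    refine ⟨S, hl, hr, fun i => by rw [map_add, hεc, hει, add_zero], hεg, fun i => h2 _,
      fun i j hij => e.injective (π.injective (hι (add_left_cancel hij))), hg2, hg, hg', ?_⟩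
    obtain ⟨s, hs, hs0⟩ := exists_four_points hn
    refine ⟨s.map (e.trans π).symm.toEmbedding, by simpa using hs, ?_⟩
    rw [Finset.sum_map]
    simp only [Equiv.coe_toEmbedding]
    have hcancel : ∀ x, π (e ((e.trans π).symm x)) = x := fun x =>
      (e.trans π).apply_symm_apply x
    simp only [hcancel, Finset.sum_add_distrib, Finset.sum_const, hs, h4, zero_add]
    rw [← map_sum, hs0, map_zero]
  obtain ⟨S₁, hS₁⟩ := main 1
  obtain ⟨S₂, hS₂⟩ := main (cyclePerm hk)
  set R := (S₁.prod (S₂ - S₁)).range with hR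
  have hRl : ∀ x, (c + ι x, ι (cyclePerm hk x - x)) ∈ R := fun x => by
    refine ⟨(Pi.single (e.symm x) 1, 0), ?_⟩
    simp [hS₁.left, hS₂.left]
  have hRr : ∀ j, (g j, (0 : Amb γ δ)) ∈ R := fun j => by
    refine ⟨(0, Pi.single j 1), ?_⟩
    simp [hS₁.right, hS₂.right]
  have hR1 : ∀ y, (y, (0 : Amb γ δ)) ∈ R := fun y => by
    refine hgen (R.comap (AddMonoidHom.inl _ (Amb γ δ))) hRr (fun x a b hab ha hb => ?_) y
    have := hRl x
    rwa [cyclePerm_fixed hk hab ha hb, sub_self, map_zero] at this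
  have hR2 : ∀ w ∈ (firstCoords n k).map ι, ((0 : Amb γ δ), w) ∈ R := by
    rintro _ ⟨w, hw, rfl⟩
    refine firstCoords_le hk (R.comap ((AddMonoidHom.inr _ _).comp ι)) (fun x => ?_) hw
    have := sub_mem (hRl x) (hR1 (c + ι x))
    simpa using this
  have hW : ∀ v, S₂ v - S₁ v ∈ (firstCoords n k).map ι := fun v => by
    rw [← AddMonoidHom.sub_apply, hom_apply_eq_sum]
    refine add_mem (sum_mem fun i _ => ?_) (sum_mem fun j _ => ?_)
    · rw [map_single_left]
      refine nsmul_mem ?_ _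
      rw [AddMonoidHom.sub_apply, hS₁.left, hS₂.left, add_sub_add_left_eq_sub, ← map_sub]
      exact ⟨_, cyclePerm_sub_mem hk _, rfl⟩
    · rw [map_single_right]
      refine nsmul_mem ?_ _
      rw [AddMonoidHom.sub_apply, hS₁.right, hS₂.right, sub_self]
      exact zero_mem _
  have hs1 : Function.Surjective S₁ := fun y => by
    obtain ⟨v, hv⟩ := hR1 y
    exact ⟨v, congrArg Prod.fst hv⟩
  have hs2 : Function.Surjective S₂ := fun y => by
    obtain ⟨v, hv⟩ := hR1 y
    have h1 : S₁ v = y := congrArg Prod.fst hv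
    have h3 : S₂ v - S₁ v = 0 := congrArg Prod.snd hv
    exact ⟨v, by rw [sub_eq_zero.1 h3, h1]⟩
  have hα : 1 ≤ 2 ^ n := Nat.one_le_two_pow
  refine ⟨S₁.ker, S₂.ker, isAddExtPerfect_ker hS₁ hs1 hα hαβ hγδ,
    isAddExtPerfect_ker hS₂ hs2 hα hαβ hγδ, isOfType_dualCode_ker S₁ hs1,
    isOfType_dualCode_ker S₂ hs2, ?_⟩
  have hcard := card_ker_inf_ker S₁ S₂ _ hW hR1 hR2
  have hWc : Nat.card ((firstCoords n k).map ι) = 2 ^ k := by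
    rw [← card_firstCoords hk]
    exact (Nat.card_congr ((firstCoords n k).equivMapOfInjective ι hι).toEquiv).symm
  rw [card_amb, card_amb, hαβ, hγδ, hWc, ← pow_add] at hcard
  refine Nat.eq_of_mul_eq_mul_right (Nat.pow_pos (n := t + 1 + k) (Nat.zero_lt_two)) ?_
  rw [hcard, ← pow_add]
  congr 1
  omega

/-- The parity coordinate of a syndrome. -/
def headHom (m δ : ℕ) : Amb (m + 1) δ →+ Z2 :=
  (Pi.evalAddMonoidHom _ 0).comp (AddMonoidHom.fst _ _)

/-- Codes of dual type `(2^t, 0; t + 1, 0)`. -/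
lemma exists_pair_binary {t k : ℕ} (ht : 3 ≤ t) (hk : k ≤ t) (hkt : t + 1 + k ≤ 2 ^ t) :
    ∃ C₁ C₂ : AddSubgroup (Amb (2 ^ t) 0),
      isAddExtPerfect t (2 ^ t) 0 C₁ ∧ isAddExtPerfect t (2 ^ t) 0 C₂ ∧
      isOfType (dualCode C₁) (t + 1) 0 ∧ isOfType (dualCode C₂) (t + 1) 0 ∧
      Nat.card ↥(C₁ ⊓ C₂) = 2 ^ (2 ^ t - (t + 1 + k)) := by
  let ι : (Fin t → Z2) →+ Amb (t + 1) 0 := AddMonoidHom.mk' (fun x => (Fin.cons 0 x, 0))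
    fun a b => Prod.ext (funext fun i => by induction i using Fin.cases <;> simp) (by simp)
  refine exists_pair (by omega) hk (by simp) (by simp) hkt ι ?_ (Pi.single 0 1, 0) ?_
    (fun j => j.elim0) (headHom t 0) ?_ ?_ (fun j => j.elim0) (fun j => j.elim0)
    (fun j => j.elim0) (fun j => j.elim0) ?_
  · intro a b hab
    exact Fin.cons_right_injective (α := fun _ => Z2) 0 (congrArg Prod.fst hab)
  · have : (1 + 1 : Z2) = 0 := by decide
    rw [Prod.mk_add_mk, ← Pi.single_add, this]
    simp
  · simp [headHom]
  · intro x
    simp [headHom, ι]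
  · intro R _ hR
    have hsingle : ∀ i : Fin t, ι (Pi.single i 1) ∈ R := by
      intro i
      obtain ⟨a, b, hai, hbi, hab⟩ : ∃ a b : Fin t, a ≠ i ∧ b ≠ i ∧ a ≠ b := by
        have : 1 < (Finset.univ.erase i).card := by simp; omega
        obtain ⟨a, ha, b, hb, hab⟩ := Finset.one_lt_card.1 this
        exact ⟨a, b, by simpa using ha, by simpa using hb, hab⟩
      have h1 := hR 1 a b hab rfl rfl
      have h2 := hR (1 + Pi.single i 1) a b hab (by simp [hai]) (by simp [hbi])
      have := sub_mem h2 h1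
      rwa [add_sub_add_left_eq_sub, ← map_sub, add_sub_cancel_left] at this
    have hall : ∀ x, ι x ∈ R := by
      intro x
      have := eq_top_of_single_mem (γ := t) (δ := 0)
        (R.comap (ι.comp (AddMonoidHom.fst _ _))) hsingle (fun j => j.elim0) (x, 0)
      exact this
    refine eq_top_of_single_mem R (fun i => ?_) (fun j => j.elim0)
    induction i using Fin.cases with
    | zero =>
      have h1 := hR 1 ⟨0, by omega⟩ ⟨1, by omega⟩ (by simp) rfl rfl
      simpa using sub_mem h1 (hall 1)
    | succ i =>
      convert hsingle i using 1
      refine Prod.ext (funext fun j => ?_) rfl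
      induction j using Fin.cases <;> simp [ι, Pi.single_apply]

/-- Codes of dual type `(2^(m+1), 2^m; m + 1, 1)`. -/
lemma exists_pair_mixed {m k : ℕ} (hm : 1 ≤ m) (hk : k ≤ m + 1)
    (hkt : m + 2 + 1 + k ≤ 2 ^ (m + 2)) :
    ∃ C₁ C₂ : AddSubgroup (Amb (2 ^ (m + 1)) (2 ^ m)),
      isAddExtPerfect (m + 2) (2 ^ (m + 1)) (2 ^ m) C₁ ∧
      isAddExtPerfect (m + 2) (2 ^ (m + 1)) (2 ^ m) C₂ ∧
      isOfType (dualCode C₁) (m + 1) 1 ∧ isOfType (dualCode C₂) (m + 1) 1 ∧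
      Nat.card ↥(C₁ ⊓ C₂) = 2 ^ (2 ^ (m + 2) - (m + 2 + 1 + k)) := by
  have hdbl : ∀ a b : Z2, (2 : Z4) * ((a + b).val : Z4) = 2 * (a.val : Z4) + 2 * (b.val : Z4) := by
    decide
  have hdbl_inj : ∀ a b : Z2, (2 : Z4) * (a.val : Z4) = 2 * (b.val : Z4) → a = b := by decide
  let ι : (Fin (m + 1) → Z2) →+ Amb (m + 1) 1 :=
    AddMonoidHom.mk' (fun x => (Fin.cons 0 (Fin.tail x), fun _ => 2 * ((x 0).val : Z4)))
      fun a b => Prod.ext (funext fun i => by induction i using Fin.cases <;> simp [Fin.tail])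
        (funext fun _ => hdbl _ _)
  let e : Fin (2 ^ m) ≃ (Fin m → Z2) :=
    (Fintype.equivFinOfCardEq (by simp [ZMod.card])).symm
  let q : (Fin m → Z2) → Amb (m + 1) 1 := fun u => (Fin.cons 1 u, fun _ => 1)
  have hneg : ∀ a : Z2, -a = a := by decide
  have hne : ∀ i j, i ≠ j → (q (e i)).1 ≠ (q (e j)).1 := fun i j hij h0 =>
    hij (e.injective (Fin.cons_right_injective (α := fun _ => Z2) 1 h0))
  refine exists_pair (by omega) hk (by ring) (by ring) hkt ι ?_ (Pi.single 0 1, 0) ?_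
    (fun j => q (e j)) (headHom m 1) ?_ ?_ ?_ ?_ ?_ ?_ ?_
  · intro a b hab
    have h1 : Fin.tail a = Fin.tail b :=
      Fin.cons_right_injective (α := fun _ => Z2) 0 (congrArg Prod.fst hab)
    have h2 : a 0 = b 0 := hdbl_inj _ _ (congrFun (congrArg Prod.snd hab) 0)
    rw [← Fin.cons_self_tail a, ← Fin.cons_self_tail b, h1, h2]
  · have : (1 + 1 : Z2) = 0 := by decide
    rw [Prod.mk_add_mk, ← Pi.single_add, this]
    simp
  · simp [headHom]
  · intro x
    simp [headHom, ι]
  · intro j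
    simp [headHom, q]
  · intro j h0
    have h1 : (1 + 1 : Z4) = 0 := congrFun (congrArg Prod.snd h0) 0
    exact absurd h1 (by decide)
  · intro i j hij h0
    exact hne i j hij (congrArg Prod.fst h0)
  · intro i j hij h0
    refine hne i j hij ((congrArg Prod.fst h0).trans (funext fun x => hneg _))
  · intro R hq hR
    have hq : ∀ u, q u ∈ R := fun u => by simpa using hq (e.symm u)
    have htail : ∀ u : Fin m → Z2, ((Fin.cons 0 u, 0) : Amb (m + 1) 1) ∈ R := fun u => by
      convert sub_mem (hq u) (hq 0) using 1
      refine Prod.ext (funext fun i => ?_) (by simp [q])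
      induction i using Fin.cases <;> simp [q]
    have hhead : ((Pi.single 0 1, 0) : Amb (m + 1) 1) ∈ R := by
      have h1 := hR 1 ⟨0, by omega⟩ ⟨1, by omega⟩ (by simp) rfl rfl
      convert sub_mem h1 (add_mem (htail 1) (add_mem (hq 0) (hq 0))) using 1
      have h3 : (1 + 1 : Z2) = 0 := by decide
      have h4 : (0 : Z4) = 2 * ((1 : Z2).val : Z4) - (1 + 1) := by decide
      refine Prod.ext (funext fun i => ?_) (funext fun j => ?_)
      · induction i using Fin.cases <;> simp [q, ι, h3, Fin.tail]
      · simpa [q, ι] using h4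
    refine eq_top_of_single_mem R (fun i => ?_) (fun j => ?_)
    · induction i using Fin.cases with
      | zero => exact hhead
      | succ i =>
        convert htail (Pi.single i 1) using 1
        refine Prod.ext (funext fun j => ?_) rfl
        induction j using Fin.cases <;> simp [Pi.single_apply]
    · convert sub_mem (hq 0) hhead using 1
      refine Prod.ext (funext fun i => ?_) (funext fun i => ?_)
      · induction i using Fin.cases <;> simp [q]
      · rw [Subsingleton.elim i j]
        simp [q]

/-- attainability of all intersection numbers for additive extended
perfect codes with `α ≠ 0`, both in the `δ = 1` case and in the `δ ≠ 1` case. -/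
theorem stmt19 {t : ℕ} (ht : 3 ≤ t) :
    (∀ l : ℕ, t + 1 ≤ l → l ≤ 2 * t →
      ∃ α β γ : ℕ, 1 ≤ α ∧ α + 2 * β = 2 ^ t ∧
        ∃ C₁ C₂ : AddSubgroup (Amb α β),
          isAddExtPerfect t α β C₁ ∧ isAddExtPerfect t α β C₂ ∧
          isOfType (dualCode C₁) γ 1 ∧ isOfType (dualCode C₂) γ 1 ∧
          Nat.card ↥(C₁ ⊓ C₂) = 2 ^ (2 ^ t - l)) ∧
    (∀ l : ℕ, t + 1 ≤ l → l ≤ 2 * t + 1 →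
      ∃ α β γ δ : ℕ, 1 ≤ α ∧ α + 2 * β = 2 ^ t ∧ δ ≠ 1 ∧
        ∃ C₁ C₂ : AddSubgroup (Amb α β),
          isAddExtPerfect t α β C₁ ∧ isAddExtPerfect t α β C₂ ∧
          isOfType (dualCode C₁) γ δ ∧ isOfType (dualCode C₂) γ δ ∧
          Nat.card ↥(C₁ ⊓ C₂) = 2 ^ (2 ^ t - l)) := by
  have hpow : 2 * t + 1 ≤ 2 ^ t := by
    induction t, ht using Nat.le_induction with
    | base => norm_num
    | succ n hn ih => rw [pow_succ]; omega
  constructor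
  · intro l hl hl'
    obtain ⟨m, rfl⟩ : ∃ m, t = m + 2 := ⟨t - 2, by omega⟩
    obtain ⟨k, rfl⟩ := Nat.exists_eq_add_of_le hl
    exact ⟨2 ^ (m + 1), 2 ^ m, m + 1, Nat.one_le_two_pow, by ring,
      exists_pair_mixed (by omega) (by omega) (by omega)⟩
  · intro l hl hl'
    obtain ⟨k, rfl⟩ := Nat.exists_eq_add_of_le hl
    exact ⟨2 ^ t, 0, t + 1, 0, Nat.one_le_two_pow, by simp, by simp,
      exists_pair_binary ht (by omega) (by omega)⟩
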